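/- Let 0 < p < 1/2. There exists a constant c_p > 0, depending only on p (and on sup_n m_n), such that for every martingale f ∈ H_p(G_m) and every n ∈ ℕ, ‖σ_{M_n + 1} f‖_{L_p(μ)} ≤ c_p · M_n^{1/p − 2} · ‖f‖_{H_p}. -/

import Mathlib

open MeasureTheory Filter
open scoped ENNReal NNReal Real BigOperators

noncomputable section

namespace Vilenkin

instance (k : ℕ) : MeasurableSpace (ZMod k) := ⊤

/-- The Vilenkin group: the product of the cyclic groups `ZMod (m n)`. -/
abbrev G (m : ℕ → ℕ) : Type := ∀ n : ℕ, ZMod (m n)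

variable (m : ℕ → ℕ)

/-- The generalized powers `M_0 = 1`, `M_{n+1} = m_n M_n`. -/
def Mprod : ℕ → ℕ
  | 0 => 1
  | n + 1 => m n * Mprod n

/-- The `k`-th digit of `n` in the base-`M` expansion `n = Σ_k n_k M_k`. -/
def digit (n k : ℕ) : ℕ := (n / Mprod m k) % m k

/-- `⟨n⟩`, the smallest index of a nonzero digit. -/
def lowIdx (n : ℕ) : ℕ := sInf {j | digit m n j ≠ 0}

/-- `|n|`, the largest index of a nonzero digit. -/
def highIdx (n : ℕ) : ℕ := sSup {j | digit m n j ≠ 0}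

/-- Generalized Rademacher functions `r_k(x) = exp(2πi x_k / m_k)`. -/
def rad (k : ℕ) (x : G m) : ℂ :=
  Complex.exp (2 * Real.pi * Complex.I * ((x k).val : ℂ) / (m k : ℂ))

/-- The Vilenkin system `ψ_n = ∏_k r_k^{n_k}`. -/
def psi (n : ℕ) (x : G m) : ℂ :=
  ∏ k ∈ Finset.range (n + 1), rad m k x ^ digit m n k

/-- Dirichlet kernels `D_n = Σ_{k<n} ψ_k`. -/
def Dker (n : ℕ) (x : G m) : ℂ := ∑ k ∈ Finset.range n, psi m k x

/-- Fejér kernels `K_n = (1/n) Σ_{k<n} D_k`. -/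
def Kker (n : ℕ) (x : G m) : ℂ := (n : ℂ)⁻¹ * ∑ k ∈ Finset.range n, Dker m k x

/-- The cylinder `I_n(x)`. -/
def cylinder (n : ℕ) (x : G m) : Set (G m) := {y | ∀ j, j < n → y j = x j}

/-- `e_t`: the element with `t`-th coordinate `1` and all others `0`. -/
def eVec (t : ℕ) : G m := fun j => if j = t then 1 else 0

/-- The filtration `F_n` generated by the cylinders of level `n`. -/
def filtr (n : ℕ) : MeasurableSpace (G m) :=
  MeasurableSpace.comap (fun x (j : Fin n) => x j.val) inferInstance

/-- The normalized Haar measure on `G_m`: the probability measure giving each cylinder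
`I_n(x)` measure `1/M_n`. -/
def IsVilenkinMeasure (μ : Measure (G m)) : Prop :=
  IsProbabilityMeasure μ ∧ ∀ n x, μ (cylinder m n x) = (Mprod m n : ℝ≥0∞)⁻¹

/-- Martingales with respect to the filtration `(F_n)`. -/
def IsMartingale (μ : Measure (G m)) (f : ℕ → G m → ℂ) : Prop :=
  (∀ n, Integrable (f n) μ) ∧
  (∀ n, Measurable[filtr m n] (f n)) ∧
  (∀ n, ∀ s : Set (G m), MeasurableSet[filtr m n] s →
    ∫ x in s, f (n + 1) x ∂μ = ∫ x in s, f n x ∂μ)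

/-- The maximal function `f* = sup_n |f^{(n)}|` (with values in `ℝ≥0∞`). -/
def maximalFn (f : ℕ → G m → ℂ) (x : G m) : ℝ≥0∞ := ⨆ n, (‖f n x‖₊ : ℝ≥0∞)

/-- The martingale Hardy space quasi-norm `‖f‖_{H_p} = ‖f*‖_{L_p}`. -/
def hardyNorm (p : ℝ) (μ : Measure (G m)) (f : ℕ → G m → ℂ) : ℝ≥0∞ :=
  (∫⁻ x, maximalFn m f x ^ p ∂μ) ^ (1 / p)

/-- Vilenkin-Fourier coefficients of an integrable function. -/
def fourierCoeff (μ : Measure (G m)) (g : G m → ℂ) (k : ℕ) : ℂ :=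
  ∫ x, g x * (starRingEnd ℂ) (psi m k x) ∂μ

/-- Partial sums `S_n g` of the Vilenkin-Fourier series of a function. -/
def SFun (μ : Measure (G m)) (g : G m → ℂ) (n : ℕ) (x : G m) : ℂ :=
  ∑ k ∈ Finset.range n, fourierCoeff m μ g k * psi m k x

/-- Fejér means `σ_n g` of a function. -/
def sigmaFun (μ : Measure (G m)) (g : G m → ℂ) (n : ℕ) (x : G m) : ℂ :=
  (n : ℂ)⁻¹ * ∑ k ∈ Finset.range n, SFun m μ g k x

/-- Vilenkin-Fourier coefficients of a martingale:
`f̂(i) = lim_k ∫ f^{(k)} ψ̄_i dμ`. -/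
def martCoeff (μ : Measure (G m)) (f : ℕ → G m → ℂ) (i : ℕ) : ℂ :=
  limUnder atTop fun k => ∫ x, f k x * (starRingEnd ℂ) (psi m i x) ∂μ

/-- Partial sums `S_n f` of the Vilenkin-Fourier series of a martingale. -/
def SMart (μ : Measure (G m)) (f : ℕ → G m → ℂ) (n : ℕ) (x : G m) : ℂ :=
  ∑ k ∈ Finset.range n, martCoeff m μ f k * psi m k x

/-- Fejér means `σ_n f` of a martingale. -/
def sigmaMart (μ : Measure (G m)) (f : ℕ → G m → ℂ) (n : ℕ) (x : G m) : ℂ :=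
  (n : ℂ)⁻¹ * ∑ k ∈ Finset.range n, SMart m μ f k x

/-- The weak `L_p` quasi-norm `‖g‖_{L_{p,∞}} = (sup_λ λ^p μ(|g|>λ))^{1/p}`. -/
def weakNorm (p : ℝ) (μ : Measure (G m)) (g : G m → ℂ) : ℝ≥0∞ :=
  (⨆ lam : ℝ≥0, (lam : ℝ≥0∞) ^ p * μ {x | (lam : ℝ) < ‖g x‖}) ^ (1 / p)

/-- A `p`-atom with prescribed support interval `I_N(x₀)`. -/
def IsPAtomAt (p : ℝ) (μ : Measure (G m)) (N : ℕ) (x₀ : G m) (a : G m → ℂ) : Prop :=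
  Measurable a ∧ Function.support a ⊆ cylinder m N x₀ ∧
    (∫ x in cylinder m N x₀, a x ∂μ) = 0 ∧
    eLpNorm a ⊤ μ ≤ μ (cylinder m N x₀) ^ (-(1 / p))

/-- A `p`-atom. -/
def IsPAtom (p : ℝ) (μ : Measure (G m)) (a : G m → ℂ) : Prop :=
  ∃ N x₀, IsPAtomAt m p μ N x₀ a

/-- The sets `I_N^{i,j}` for `i < j ≤ N`. -/
def IsetIJ (N i j : ℕ) : Set (G m) :=
  if j < N then
    {x | (∀ l, l < i → x l = 0) ∧ x i ≠ 0 ∧ (∀ l, i < l → l < j → x l = 0) ∧ x j ≠ 0}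
  else
    {x | (∀ l, l < i → x l = 0) ∧ x i ≠ 0 ∧ (∀ l, i < l → l < N → x l = 0)}

/-- The finite set of cylinders of level `n`, indexed by the first `n` coordinates. -/
abbrev Cell (n : ℕ) : Type := ∀ j : Fin n, ZMod (m j.val)

/-- The cylinder of level `n` containing a given point. -/
def toCell (n : ℕ) (x : G m) : Cell m n := fun j => x j.val

/-- The point of a cylinder all of whose remaining coordinates vanish. -/
def ofCell (n : ℕ) (c : Cell m n) : G m := fun j => if h : j < n then c ⟨j, h⟩ else 0

lemma toCell_ofCell (n : ℕ) (c : Cell m n) : toCell m n (ofCell m n c) = c := by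
  funext j
  simp [toCell, ofCell]

lemma measurable_toCell (n : ℕ) : Measurable (toCell m n) :=
  measurable_pi_lambda _ fun _ => measurable_pi_apply _

lemma toCell_preimage (n : ℕ) (c : Cell m n) :
    toCell m n ⁻¹' {c} = cylinder m n (ofCell m n c) := by
  ext x
  simp only [Set.mem_preimage, Set.mem_singleton_iff, cylinder, Set.mem_ofPred_eq]
  constructor
  · rintro rfl j hj
    simp [ofCell, toCell, hj]
  · intro h
    funext j
    simpa [ofCell, toCell] using h j.val j.isLt

variable {m}

lemma eq_of_toCell_eq {n : ℕ} {g : G m → ℂ} (hg : Measurable[filtr m n] g) {x y : G m}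
    (h : toCell m n x = toCell m n y) : g x = g y := by
  obtain ⟨s, -, hs⟩ := hg (measurableSet_singleton (g y))
  have hy : y ∈ g ⁻¹' {g y} := rfl
  have hx : x ∈ g ⁻¹' {g y} := by
    rw [← hs] at hy ⊢
    change toCell m n x ∈ s
    rw [h]
    exact hy
  exact hx

lemma Mprod_pos (hm : ∀ n, 2 ≤ m n) (n : ℕ) : 0 < Mprod m n := by
  induction n with
  | zero => simp [Mprod]
  | succ n ih => exact Nat.mul_pos (by have := hm n; omega) ih

lemma Mprod_mul_two_pow_le (hm : ∀ n, 2 ≤ m n) (k d : ℕ) :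
    Mprod m k * 2 ^ d ≤ Mprod m (k + d) := by
  induction d with
  | zero => simp
  | succ d ih =>
    calc Mprod m k * 2 ^ (d + 1) = 2 * (Mprod m k * 2 ^ d) := by ring
      _ ≤ m (k + d) * Mprod m (k + d) := Nat.mul_le_mul (hm _) ih

lemma Mprod_mono (hm : ∀ n, 2 ≤ m n) {k n : ℕ} (h : k ≤ n) : Mprod m k ≤ Mprod m n := by
  obtain ⟨d, rfl⟩ := Nat.exists_eq_add_of_le h
  exact (Nat.le_mul_of_pos_right _ (by positivity)).trans (Mprod_mul_two_pow_le hm k d)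

lemma Mprod_dvd {k n : ℕ} (h : k ≤ n) : Mprod m k ∣ Mprod m n := by
  induction n, h using Nat.le_induction with
  | base => exact dvd_rfl
  | succ n _ ih => exact ih.mul_left _

lemma lt_Mprod (hm : ∀ n, 2 ≤ m n) (n : ℕ) : n < Mprod m n := by
  have := Mprod_mul_two_pow_le hm 0 n
  simp only [Mprod, one_mul, zero_add] at this
  exact n.lt_two_pow_self.trans_le this

lemma digit_eq_zero (hm : ∀ n, 2 ≤ m n) {i n k : ℕ} (hi : i < Mprod m n) (hk : n ≤ k) :
    digit m i k = 0 := by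
  simp [digit, Nat.div_eq_of_lt (hi.trans_le (Mprod_mono hm hk))]

lemma digit_add_of_lt (hm : ∀ n, 2 ≤ m n) {n l : ℕ} (hl : l < n) (q r : ℕ) :
    digit m (r + Mprod m n * q) l = digit m r l := by
  obtain ⟨d, hd⟩ : Mprod m (l + 1) ∣ Mprod m n := Mprod_dvd hl
  have : r + Mprod m n * q = r + Mprod m l * (m l * (d * q)) := by
    rw [hd, Mprod]; ring
  rw [digit, this, Nat.add_mul_div_left _ _ (Mprod_pos hm l), Nat.add_mul_mod_self_left, digit]

lemma digit_add_self (hm : ∀ n, 2 ≤ m n) {n q r : ℕ} (hr : r < Mprod m n) (hq : q < m n) :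
    digit m (r + Mprod m n * q) n = q := by
  rw [digit, Nat.add_mul_div_left _ _ (Mprod_pos hm n), Nat.div_eq_of_lt hr, zero_add,
    Nat.mod_eq_of_lt hq]

lemma eq_sum_digit (hm : ∀ n, 2 ≤ m n) (n : ℕ) :
    ∀ i < Mprod m n, i = ∑ k ∈ Finset.range n, digit m i k * Mprod m k := by
  induction n with
  | zero => intro i hi; simpa [Mprod] using hi
  | succ n ih =>
    intro i hi
    have hr := Nat.mod_lt i (Mprod_pos hm n)
    have hq : i / Mprod m n < m n := Nat.div_lt_of_lt_mul (by rw [mul_comm]; exact hi)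
    have hi' := Nat.mod_add_div i (Mprod m n)
    have h1 := digit_add_self hm hr hq
    rw [hi'] at h1
    rw [Finset.sum_range_succ, h1]
    conv_lhs => rw [← hi', ih _ hr]
    congr 1
    · refine Finset.sum_congr rfl fun l hl => ?_
      have h2 := digit_add_of_lt hm (Finset.mem_range.1 hl) (i / Mprod m n) (i % Mprod m n)
      rw [hi'] at h2
      rw [h2]
    · ring

lemma sum_prod_digit (hm : ∀ n, 2 ≤ m n) (n : ℕ) (g : ℕ → ℕ → ℂ) :
    ∑ i ∈ Finset.range (Mprod m n), ∏ l ∈ Finset.range n, g l (digit m i l) =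
      ∏ l ∈ Finset.range n, ∑ j ∈ Finset.range (m l), g l j := by
  induction n with
  | zero => simp [Mprod]
  | succ n ih =>
    have hsplit : ∀ h : ℕ → ℂ, ∑ i ∈ Finset.range (Mprod m (n + 1)), h i =
        ∑ q ∈ Finset.range (m n), ∑ r ∈ Finset.range (Mprod m n), h (r + Mprod m n * q) := by
      intro h
      rw [Mprod]
      induction m n with
      | zero => simp
      | succ b ihb =>
        rw [Finset.sum_range_succ, ← ihb, add_mul, one_mul, Finset.sum_range_add]
        simp [add_comm, mul_comm]
    rw [hsplit, Finset.prod_range_succ, ← ih, mul_comm, Finset.sum_mul]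
    refine Finset.sum_congr rfl fun q hq => ?_
    rw [Finset.mul_sum]
    refine Finset.sum_congr rfl fun r hr => ?_
    rw [Finset.prod_range_succ, digit_add_self hm (Finset.mem_range.1 hr) (Finset.mem_range.1 hq),
      mul_comm]
    congr 1
    exact Finset.prod_congr rfl fun l hl => by rw [digit_add_of_lt hm (Finset.mem_range.1 hl)]

lemma psi_eq_prod (hm : ∀ n, 2 ≤ m n) {i n : ℕ} (hi : i < Mprod m n) (x : G m) :
    psi m i x = ∏ k ∈ Finset.range n, rad m k x ^ digit m i k := by
  have h1 : ∀ a b : ℕ, i < Mprod m a → a ≤ b →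
      ∏ k ∈ Finset.range a, rad m k x ^ digit m i k =
        ∏ k ∈ Finset.range b, rad m k x ^ digit m i k := by
    intro a b ha hab
    refine Finset.prod_subset (Finset.range_mono hab) fun k _ hk => ?_
    rw [digit_eq_zero hm ha (by simpa using hk), pow_zero]
  have h2 : i < Mprod m (i + 1) := (Nat.lt_succ_self i).trans (lt_Mprod hm _)
  rw [psi, h1 _ _ h2 (le_max_left _ n), h1 _ _ hi (le_max_right (i + 1) n)]

lemma rad_eq_pow (k : ℕ) (x : G m) :
    rad m k x = Complex.exp (2 * Real.pi * Complex.I / (m k : ℂ)) ^ (x k).val := by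
  rw [rad, ← Complex.exp_nat_mul]
  congr 1
  ring

lemma norm_rad (k : ℕ) (x : G m) : ‖rad m k x‖ = 1 := by
  rw [rad, Complex.norm_exp, Real.exp_eq_one_iff]
  have : 2 * Real.pi * Complex.I * ((x k).val : ℂ) / (m k : ℂ) =
      ((2 * Real.pi * (x k).val / m k : ℝ) : ℂ) * Complex.I := by
    push_cast; ring
  rw [this]
  simp

lemma norm_rad_mul_conj (k : ℕ) (x y : G m) :
    ‖rad m k x * (starRingEnd ℂ) (rad m k y)‖ = 1 := by
  rw [norm_mul, RCLike.norm_conj, norm_rad, norm_rad, one_mul]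

lemma rad_mul_conj_self (k : ℕ) (x : G m) : rad m k x * (starRingEnd ℂ) (rad m k x) = 1 := by
  rw [Complex.mul_conj, Complex.normSq_eq_norm_sq, norm_rad]
  simp

lemma sum_rad_mul_conj_pow (hm : ∀ n, 2 ≤ m n) (k : ℕ) (x y : G m) :
    ∑ j ∈ Finset.range (m k), (rad m k x * (starRingEnd ℂ) (rad m k y)) ^ j =
      if y k = x k then (m k : ℂ) else 0 := by
  have : NeZero (m k) := ⟨by have := hm k; omega⟩
  have hζ := Complex.isPrimitiveRoot_exp (m k) (NeZero.ne _)
  split_ifs with h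
  · have : rad m k x = rad m k y := by rw [rad, rad, h]
    simp [this, rad_mul_conj_self]
  · have hone : ∀ z : G m, rad m k z ^ m k = 1 := fun z => by
      rw [rad_eq_pow, pow_right_comm, hζ.pow_eq_one, one_pow]
    have hne : rad m k x * (starRingEnd ℂ) (rad m k y) ≠ 1 := by
      intro h1
      apply h
      have h2 : rad m k x = rad m k y := by
        calc rad m k x = rad m k x * (rad m k y * (starRingEnd ℂ) (rad m k y)) := by
              rw [rad_mul_conj_self, mul_one]
          _ = (rad m k x * (starRingEnd ℂ) (rad m k y)) * rad m k y := by ring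
          _ = rad m k y := by rw [h1, one_mul]
      rw [rad_eq_pow, rad_eq_pow] at h2
      exact (ZMod.val_injective _ (hζ.pow_inj (ZMod.val_lt _) (ZMod.val_lt _) h2)).symm
    rw [geom_sum_eq hne, mul_pow, ← map_pow, hone, hone]
    simp

lemma prod_natCast_range (n : ℕ) : ∏ l ∈ Finset.range n, (m l : ℝ) = Mprod m n := by
  induction n with
  | zero => simp [Mprod]
  | succ n ih => rw [Finset.prod_range_succ, ih, Mprod]; push_cast; ring

lemma psi_mul_conj (hm : ∀ n, 2 ≤ m n) {i n : ℕ} (hi : i < Mprod m n) (x y : G m) :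
    psi m i x * (starRingEnd ℂ) (psi m i y) =
      ∏ l ∈ Finset.range n, (rad m l x * (starRingEnd ℂ) (rad m l y)) ^ digit m i l := by
  rw [psi_eq_prod hm hi, psi_eq_prod hm hi, map_prod, ← Finset.prod_mul_distrib]
  simp [mul_pow]

lemma norm_sum_psi_mul_conj_le (hm : ∀ n, 2 ≤ m n) (n : ℕ) (x y : G m) :
    ‖∑ i ∈ Finset.range (Mprod m n), psi m i x * (starRingEnd ℂ) (psi m i y)‖ ≤
      if toCell m n y = toCell m n x then (Mprod m n : ℝ) else 0 := by
  rw [Finset.sum_congr rfl fun i hi => psi_mul_conj hm (Finset.mem_range.1 hi) x y,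
    sum_prod_digit hm n fun l j => (rad m l x * (starRingEnd ℂ) (rad m l y)) ^ j, norm_prod]
  simp only [sum_rad_mul_conj_pow hm]
  split_ifs with h
  · rw [← prod_natCast_range]
    refine Finset.prod_le_prod (fun _ _ => norm_nonneg _) fun l _ => ?_
    split_ifs <;> simp
  · obtain ⟨j, hj⟩ := Function.ne_iff.1 h
    refine (Finset.prod_eq_zero (Finset.mem_range.2 j.isLt) ?_).le
    rw [if_neg (show ¬ y j = x j from hj), norm_zero]

lemma norm_sum_digit_mul_psi_mul_conj_le (hm : ∀ n, 2 ≤ m n) {n : ℕ} (k : Fin n) (x y : G m) :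
    ‖∑ i ∈ Finset.range (Mprod m n),
        (digit m i k : ℂ) * (psi m i x * (starRingEnd ℂ) (psi m i y))‖ ≤
      if ∀ l : Fin n, l ≠ k → y l = x l then (m k * Mprod m n : ℝ) else 0 := by
  classical
  have hk : k.val ∈ Finset.range n := Finset.mem_range.2 k.isLt
  set ρ : ℕ → ℂ := fun l => rad m l x * (starRingEnd ℂ) (rad m l y) with hρ
  set g : ℕ → ℕ → ℂ := fun l j => (if l = k.val then (j : ℂ) else 1) * ρ l ^ j with hg
  have hterm : ∀ i ∈ Finset.range (Mprod m n),
      (digit m i k : ℂ) * (psi m i x * (starRingEnd ℂ) (psi m i y)) =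
        ∏ l ∈ Finset.range n, g l (digit m i l) := by
    intro i hi
    simp only [hg]
    rw [psi_mul_conj hm (Finset.mem_range.1 hi), Finset.prod_mul_distrib,
      Finset.prod_ite_eq' (Finset.range n) k.val, if_pos hk]
  rw [Finset.sum_congr rfl hterm, sum_prod_digit hm, norm_prod]
  have hself : ‖∑ j ∈ Finset.range (m k), (j : ℂ) * ρ k ^ j‖ ≤ (m k : ℝ) * m k := by
    refine (norm_sum_le _ _).trans ?_
    calc ∑ j ∈ Finset.range (m k), ‖(j : ℂ) * ρ k ^ j‖
        ≤ ∑ _j ∈ Finset.range (m k), (m k : ℝ) := by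
          refine Finset.sum_le_sum fun j hj => ?_
          rw [norm_mul, norm_pow, norm_rad_mul_conj, one_pow, mul_one, Complex.norm_natCast]
          exact_mod_cast (Finset.mem_range.1 hj).le
      _ = (m k : ℝ) * m k := by simp
  split_ifs with h
  · rw [← prod_natCast_range, ← Finset.mul_prod_erase _ _ hk, ← Finset.mul_prod_erase _ _ hk,
      ← mul_assoc]
    refine mul_le_mul (by simpa [hg] using hself) ?_ (by positivity) (by positivity)
    refine Finset.prod_le_prod (fun _ _ => norm_nonneg _) fun l hl => ?_
    simp only [hg, if_neg (Finset.ne_of_mem_erase hl), one_mul, hρ, sum_rad_mul_conj_pow hm]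
    split_ifs <;> simp
  · push Not at h
    obtain ⟨l, hl, hne⟩ := h
    refine (Finset.prod_eq_zero (Finset.mem_range.2 l.isLt) ?_).le
    have : l.val ≠ k.val := fun e => hl (Fin.ext e)
    simp only [hg, if_neg this, one_mul, hρ, sum_rad_mul_conj_pow hm, if_neg hne, norm_zero]

lemma sum_range_sum_range (g : ℕ → ℂ) (N : ℕ) :
    ∑ k ∈ Finset.range (N + 1), ∑ i ∈ Finset.range k, g i =
      ∑ i ∈ Finset.range N, ((N : ℂ) - i) * g i := by
  induction N with
  | zero => simp
  | succ N ih =>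
    rw [Finset.sum_range_succ, ih, Finset.sum_range_succ, Finset.sum_range_succ, ← add_assoc,
      ← Finset.sum_add_distrib]
    congr 1
    · exact Finset.sum_congr rfl fun i _ => by push_cast; ring
    · push_cast; ring

lemma norm_weighted_sum_psi_mul_conj_le (hm : ∀ n, 2 ≤ m n) (n : ℕ) (x y : G m) :
    ‖∑ i ∈ Finset.range (Mprod m n),
        ((Mprod m n : ℂ) - i) * (psi m i x * (starRingEnd ℂ) (psi m i y))‖ ≤
      Mprod m n * (if toCell m n y = toCell m n x then (Mprod m n : ℝ) else 0) +
        ∑ k : Fin n, Mprod m k *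
          (if ∀ l : Fin n, l ≠ k → y l = x l then (m k * Mprod m n : ℝ) else 0) := by
  have hsplit : ∑ i ∈ Finset.range (Mprod m n),
        ((Mprod m n : ℂ) - i) * (psi m i x * (starRingEnd ℂ) (psi m i y)) =
      Mprod m n * ∑ i ∈ Finset.range (Mprod m n), psi m i x * (starRingEnd ℂ) (psi m i y) -
        ∑ k : Fin n, Mprod m k * ∑ i ∈ Finset.range (Mprod m n),
          (digit m i k : ℂ) * (psi m i x * (starRingEnd ℂ) (psi m i y)) := by
    simp only [Finset.mul_sum]
    rw [Finset.sum_comm, ← Finset.sum_sub_distrib]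
    refine Finset.sum_congr rfl fun i hi => ?_
    rw [sub_mul]
    congr 1
    have hd : (i : ℂ) = ∑ k : Fin n, (digit m i k : ℂ) * Mprod m k := by
      rw [Fin.sum_univ_eq_sum_range fun k => (digit m i k : ℂ) * Mprod m k]
      exact_mod_cast eq_sum_digit hm n i (Finset.mem_range.1 hi)
    conv_lhs => rw [hd]
    rw [Finset.sum_mul]
    exact Finset.sum_congr rfl fun k _ => by ring
  rw [hsplit]
  refine (norm_sub_le _ _).trans (add_le_add ?_ ((norm_sum_le _ _).trans ?_))
  · rw [norm_mul, Complex.norm_natCast]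
    gcongr
    exact norm_sum_psi_mul_conj_le hm n x y
  · refine Finset.sum_le_sum fun k _ => ?_
    rw [norm_mul, Complex.norm_natCast]
    gcongr
    exact norm_sum_digit_mul_psi_mul_conj_le hm k x y

lemma psi_congr (hm : ∀ n, 2 ≤ m n) {i n : ℕ} (hi : i < Mprod m n) {x y : G m}
    (h : toCell m n x = toCell m n y) : psi m i x = psi m i y := by
  rw [psi_eq_prod hm hi, psi_eq_prod hm hi]
  refine Finset.prod_congr rfl fun k hk => ?_
  have : x k = y k := congrFun h ⟨k, Finset.mem_range.1 hk⟩
  rw [rad, rad, this]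

lemma map_toCell_singleton {μ : Measure (G m)} (hμ : IsVilenkinMeasure m μ) (n : ℕ)
    (c : Cell m n) : μ.map (toCell m n) {c} = (Mprod m n : ℝ≥0∞)⁻¹ := by
  rw [Measure.map_apply (measurable_toCell m n) (measurableSet_singleton c), toCell_preimage,
    hμ.2]

section Finite

variable [∀ n, NeZero (m n)]

lemma lintegral_comp_toCell {μ : Measure (G m)} (hμ : IsVilenkinMeasure m μ) (n : ℕ)
    (H : Cell m n → ℝ≥0∞) :
    ∫⁻ x, H (toCell m n x) ∂μ = (Mprod m n : ℝ≥0∞)⁻¹ * ∑ c, H c := by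
  rw [← lintegral_map (measurable_of_countable H) (measurable_toCell m n), lintegral_fintype,
    Finset.mul_sum]
  simp only [map_toCell_singleton hμ, mul_comm]

lemma integral_comp_toCell {μ : Measure (G m)} (hμ : IsVilenkinMeasure m μ) (n : ℕ)
    (H : Cell m n → ℂ) :
    ∫ x, H (toCell m n x) ∂μ = (Mprod m n : ℂ)⁻¹ * ∑ c, H c := by
  have := hμ.1
  have := Measure.isProbabilityMeasure_map (μ := μ) (measurable_toCell m n).aemeasurable
  rw [← integral_map (measurable_toCell m n).aemeasurable
    (measurable_of_countable H).aestronglyMeasurable, integral_fintype Integrable.of_finite,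
    Finset.mul_sum]
  simp [measureReal_def, map_toCell_singleton hμ]

lemma integral_mul_comp_toCell {μ : Measure (G m)} {g : G m → ℂ} (hg : Integrable g μ) (n : ℕ)
    (H : Cell m n → ℂ) :
    ∫ x, g x * H (toCell m n x) ∂μ = ∑ c, (∫ x in toCell m n ⁻¹' {c}, g x ∂μ) * H c := by
  classical
  have hms : ∀ c, MeasurableSet (toCell m n ⁻¹' {c}) := fun c =>
    measurable_toCell m n (measurableSet_singleton c)
  have hpt : ∀ x, g x * H (toCell m n x) =
      ∑ c, (toCell m n ⁻¹' {c}).indicator g x * H c := by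
    intro x
    rw [Finset.sum_eq_single (toCell m n x)]
    · simp
    · intro c _ hc
      rw [Set.indicator_of_notMem (fun h => hc h.symm), zero_mul]
    · simp
  simp only [hpt]
  rw [integral_finsetSum _ fun c _ => (hg.indicator (hms c)).mul_const _]
  refine Finset.sum_congr rfl fun c _ => ?_
  rw [integral_mul_const, integral_indicator (hms c)]

lemma IsMartingale.martCoeff_eq (hm : ∀ n, 2 ≤ m n) {μ : Measure (G m)}
    (hμ : IsVilenkinMeasure m μ) {f : ℕ → G m → ℂ} (hf : IsMartingale m μ f) {i n : ℕ}
    (hi : i < Mprod m n) :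
    martCoeff m μ f i = (Mprod m n : ℂ)⁻¹ *
      ∑ c, f n (ofCell m n c) * (starRingEnd ℂ) (psi m i (ofCell m n c)) := by
  have hpsi : ∀ N, n ≤ N → ∀ x, psi m i x = psi m i (ofCell m N (toCell m N x)) := fun N hN x =>
    psi_congr hm (hi.trans_le (Mprod_mono hm hN)) (toCell_ofCell m N _).symm
  have hconst : ∀ N, n ≤ N → ∫ x, f N x * (starRingEnd ℂ) (psi m i x) ∂μ =
      ∫ x, f n x * (starRingEnd ℂ) (psi m i x) ∂μ := by
    intro N hN
    induction N, hN using Nat.le_induction with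
    | base => rfl
    | succ N hN ih =>
      have hint : ∀ g : G m → ℂ, Integrable g μ → ∫ x, g x * (starRingEnd ℂ) (psi m i x) ∂μ =
          ∑ c, (∫ x in toCell m N ⁻¹' {c}, g x ∂μ) *
            (starRingEnd ℂ) (psi m i (ofCell m N c)) := by
        intro g hg
        rw [← integral_mul_comp_toCell hg N fun c => (starRingEnd ℂ) (psi m i (ofCell m N c))]
        refine integral_congr_ae (Eventually.of_forall fun x => ?_)
        simp only
        rw [← hpsi N hN x]
      rw [← ih, hint _ (hf.1 _), hint _ (hf.1 _)]
      refine Finset.sum_congr rfl fun c _ => ?_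
      rw [hf.2.2 N (toCell m N ⁻¹' {c}) ⟨{c}, measurableSet_singleton c, rfl⟩]
  rw [martCoeff, (tendsto_const_nhds.congr' (eventually_atTop.2
    ⟨n, fun N hN => (hconst N hN).symm⟩)).limUnder_eq]
  rw [← integral_comp_toCell hμ n fun c =>
    f n (ofCell m n c) * (starRingEnd ℂ) (psi m i (ofCell m n c))]
  refine integral_congr_ae (Eventually.of_forall fun x => ?_)
  simp only
  rw [← hpsi n le_rfl x, eq_of_toCell_eq (hf.2.1 n) (toCell_ofCell m n (toCell m n x)).symm]

lemma sigmaMart_Mprod_add_one_eq (hm : ∀ n, 2 ≤ m n) {μ : Measure (G m)}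
    (hμ : IsVilenkinMeasure m μ) {f : ℕ → G m → ℂ} (hf : IsMartingale m μ f) (n : ℕ) (x : G m) :
    sigmaMart m μ f (Mprod m n + 1) x = ((Mprod m n : ℂ) + 1)⁻¹ * ((Mprod m n : ℂ)⁻¹ *
      ∑ c, f n (ofCell m n c) * ∑ i ∈ Finset.range (Mprod m n), ((Mprod m n : ℂ) - i) *
        (psi m i x * (starRingEnd ℂ) (psi m i (ofCell m n c)))) := by
  simp only [sigmaMart, SMart]
  rw [sum_range_sum_range]
  push_cast
  congr 1
  simp only [Finset.mul_sum]
  rw [Finset.sum_comm]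
  refine Finset.sum_congr rfl fun i hi => ?_
  rw [hf.martCoeff_eq hm hμ (Finset.mem_range.1 hi)]
  simp only [Finset.mul_sum, Finset.sum_mul]
  exact Finset.sum_congr rfl fun c _ => by ring

lemma norm_sigmaMart_Mprod_add_one_le (hm : ∀ n, 2 ≤ m n) {B : ℕ} (hB : ∀ n, m n ≤ B)
    {μ : Measure (G m)} (hμ : IsVilenkinMeasure m μ) {f : ℕ → G m → ℂ}
    (hf : IsMartingale m μ f) (n : ℕ) (x : G m) :
    ‖sigmaMart m μ f (Mprod m n + 1) x‖ ≤ ‖f n x‖ +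
      ∑ k : Fin n, ∑ a : ZMod (m k), (1 / 2) ^ (n - k.val) * B *
        ‖f n (ofCell m n (toCell m n x + Pi.single k a))‖ := by
  classical
  have hM : (0 : ℝ) < Mprod m n := by exact_mod_cast Mprod_pos hm n
  set F : Cell m n → ℝ := fun c => ‖f n (ofCell m n c)‖ with hF
  have hF0 : ∀ c, 0 ≤ F c := fun c => norm_nonneg _
  have hFx : ‖f n x‖ = F (toCell m n x) := by
    rw [hF, eq_of_toCell_eq (hf.2.1 n) (toCell_ofCell m n (toCell m n x)).symm]
  have hdiag : ∑ c, F c * (if c = toCell m n x then (Mprod m n : ℝ) else 0) =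
      Mprod m n * ‖f n x‖ := by
    rw [hFx]
    simp [mul_comm]
  have hoff : ∀ k : Fin n, ∑ c, F c *
      (if ∀ l : Fin n, l ≠ k → ofCell m n c l = x l then (m k * Mprod m n : ℝ) else 0) ≤
      Mprod m n * (B * ∑ a : ZMod (m k), F (toCell m n x + Pi.single k a)) := by
    intro k
    have hle : ∀ c, F c *
        (if ∀ l : Fin n, l ≠ k → ofCell m n c l = x l then (m k * Mprod m n : ℝ) else 0) ≤
        ∑ a : ZMod (m k), if c = toCell m n x + Pi.single k a then
          F c * (m k * Mprod m n : ℝ) else 0 := by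
      intro c
      have hnn : ∀ a ∈ (Finset.univ : Finset (ZMod (m k))),
          0 ≤ if c = toCell m n x + Pi.single k a then F c * (m k * Mprod m n : ℝ) else 0 := by
        intro a _
        split_ifs
        · exact mul_nonneg (hF0 c) (by positivity)
        · exact le_rfl
      split_ifs with h
      · refine le_trans ?_ (Finset.single_le_sum hnn (Finset.mem_univ (c k - x k)))
        rw [if_pos]
        funext l
        by_cases hl : l = k
        · subst hl
          simp [toCell]
        · have := h l hl
          simp only [ofCell, l.isLt, dif_pos] at this
          simpa [hl, toCell] using this
      · rw [mul_zero]
        exact Finset.sum_nonneg hnn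
    refine (Finset.sum_le_sum fun c _ => hle c).trans ?_
    rw [Finset.sum_comm]
    simp only [Finset.sum_ite_eq', Finset.mem_univ, if_true]
    rw [← Finset.sum_mul]
    have hs : 0 ≤ ∑ a : ZMod (m k), F (toCell m n x + Pi.single k a) :=
      Finset.sum_nonneg fun _ _ => hF0 _
    have : (m k : ℝ) ≤ B := by exact_mod_cast hB k
    calc _ = Mprod m n * (m k * ∑ a : ZMod (m k), F (toCell m n x + Pi.single k a)) := by ring
      _ ≤ _ := by gcongr
  have hmain : ‖∑ c, f n (ofCell m n c) * ∑ i ∈ Finset.range (Mprod m n),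
        ((Mprod m n : ℂ) - i) * (psi m i x * (starRingEnd ℂ) (psi m i (ofCell m n c)))‖ ≤
      Mprod m n * (Mprod m n * ‖f n x‖) + ∑ k : Fin n, Mprod m k *
        (Mprod m n * (B * ∑ a : ZMod (m k), F (toCell m n x + Pi.single k a))) := by
    calc _ ≤ ∑ c, F c * (Mprod m n * (if c = toCell m n x then (Mprod m n : ℝ) else 0) +
          ∑ k : Fin n, Mprod m k * (if ∀ l : Fin n, l ≠ k → ofCell m n c l = x l then
            (m k * Mprod m n : ℝ) else 0)) := by
          refine (norm_sum_le _ _).trans (Finset.sum_le_sum fun c _ => ?_)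
          rw [norm_mul]
          refine mul_le_mul_of_nonneg_left ?_ (hF0 c)
          have := norm_weighted_sum_psi_mul_conj_le hm n x (ofCell m n c)
          rwa [toCell_ofCell] at this
      _ = Mprod m n * (∑ c, F c * (if c = toCell m n x then (Mprod m n : ℝ) else 0)) +
          ∑ k : Fin n, Mprod m k * ∑ c, F c *
            (if ∀ l : Fin n, l ≠ k → ofCell m n c l = x l then
              (m k * Mprod m n : ℝ) else 0) := by
          simp only [mul_add, Finset.sum_add_distrib, Finset.mul_sum]
          congr 1
          · exact Finset.sum_congr rfl fun c _ => by ring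
          · rw [Finset.sum_comm]
            exact Finset.sum_congr rfl fun k _ => Finset.sum_congr rfl fun c _ => by ring
      _ ≤ _ := by
          rw [hdiag]
          gcongr with k
          exact hoff k
  rw [sigmaMart_Mprod_add_one_eq hm hμ hf, norm_mul, norm_mul, norm_inv, norm_inv,
    Complex.norm_natCast]
  have hn1 : ‖(Mprod m n : ℂ) + 1‖ = (Mprod m n : ℝ) + 1 := by
    exact_mod_cast Complex.norm_natCast (Mprod m n + 1)
  rw [hn1]
  have hgeom : ∀ k : Fin n, (Mprod m k : ℝ) ≤ Mprod m n * (1 / 2) ^ (n - k.val) := by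
    intro k
    have h := Mprod_mul_two_pow_le hm k (n - k.val)
    rw [Nat.add_sub_cancel' k.isLt.le] at h
    rw [one_div, inv_pow, ← div_eq_mul_inv, le_div_iff₀ (by positivity)]
    exact_mod_cast h
  calc _ ≤ (Mprod m n : ℝ)⁻¹ * ((Mprod m n : ℝ)⁻¹ * (Mprod m n * (Mprod m n * ‖f n x‖) +
        ∑ k : Fin n, (Mprod m n * (1 / 2) ^ (n - k.val)) *
        (Mprod m n * (B * ∑ a : ZMod (m k), F (toCell m n x + Pi.single k a))))) := by
        refine mul_le_mul (inv_anti₀ hM (by linarith)) ?_ (by positivity) (by positivity)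
        refine mul_le_mul_of_nonneg_left (hmain.trans ?_) (by positivity)
        gcongr with k
        exact hgeom k
    _ = _ := by
        rw [mul_add, mul_add]
        congr 1
        · field_simp
        · simp only [Finset.mul_sum]
          refine Finset.sum_congr rfl fun k _ => Finset.sum_congr rfl fun a _ => ?_
          rw [hF]
          field_simp

lemma lintegral_translate_rpow_le {μ : Measure (G m)} (hμ : IsVilenkinMeasure m μ)
    {p : ℝ} (hp0 : 0 ≤ p) {f : ℕ → G m → ℂ} (hf : IsMartingale m μ f) (n : ℕ) (d : Cell m n) :
    ∫⁻ x, ‖f n (ofCell m n (toCell m n x + d))‖ₑ ^ p ∂μ ≤ ∫⁻ x, maximalFn m f x ^ p ∂μ := by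
  have htr : ∫⁻ x, ‖f n (ofCell m n (toCell m n x + d))‖ₑ ^ p ∂μ =
      ∫⁻ x, ‖f n (ofCell m n (toCell m n x))‖ₑ ^ p ∂μ := by
    rw [lintegral_comp_toCell hμ n fun c => ‖f n (ofCell m n (c + d))‖ₑ ^ p,
      lintegral_comp_toCell hμ n fun c => ‖f n (ofCell m n c)‖ₑ ^ p]
    congr 1
    exact Equiv.sum_comp (Equiv.addRight d) fun c => ‖f n (ofCell m n c)‖ₑ ^ p
  rw [htr]
  refine lintegral_mono fun x => ENNReal.rpow_le_rpow ?_ hp0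
  rw [eq_of_toCell_eq (hf.2.1 n) (toCell_ofCell m n (toCell m n x))]
  exact le_iSup (fun n => (‖f n x‖₊ : ℝ≥0∞)) n

end Finite

lemma rpow_sum_le_sum_rpow {ι : Type*} (s : Finset ι) (g : ι → ℝ≥0∞) {p : ℝ} (hp0 : 0 < p)
    (hp1 : p ≤ 1) : (∑ i ∈ s, g i) ^ p ≤ ∑ i ∈ s, g i ^ p := by
  classical
  induction s using Finset.induction_on with
  | empty => simp [hp0]
  | insert a s ha ih =>
    rw [Finset.sum_insert ha, Finset.sum_insert ha]
    exact (ENNReal.rpow_add_le_add_rpow _ _ hp0.le hp1).trans (by gcongr)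

lemma lintegral_sigmaMart_rpow_le (hm : ∀ n, 2 ≤ m n) {B : ℕ} (hB : ∀ n, m n ≤ B)
    {μ : Measure (G m)} (hμ : IsVilenkinMeasure m μ) {p : ℝ} (hp0 : 0 < p) (hp1 : p ≤ 1)
    {f : ℕ → G m → ℂ} (hf : IsMartingale m μ f) (n : ℕ) :
    ∫⁻ x, ‖sigmaMart m μ f (Mprod m n + 1) x‖ₑ ^ p ∂μ ≤
      (1 + (1 - (2⁻¹ : ℝ≥0∞) ^ p)⁻¹ * ((B : ℝ≥0∞) ^ p * B)) *
        ∫⁻ x, maximalFn m f x ^ p ∂μ := by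
  have : ∀ n, NeZero (m n) := fun n => ⟨by have := hm n; omega⟩
  set A := ∫⁻ x, maximalFn m f x ^ p ∂μ with hA
  have hpt : ∀ x, ‖sigmaMart m μ f (Mprod m n + 1) x‖ₑ ^ p ≤
      ‖f n (ofCell m n (toCell m n x + 0))‖ₑ ^ p +
      ∑ k : Fin n, ∑ a : ZMod (m k), ((2⁻¹ : ℝ≥0∞) ^ p) ^ (n - k.val) * (B : ℝ≥0∞) ^ p *
        ‖f n (ofCell m n (toCell m n x + Pi.single k a))‖ₑ ^ p := by
    intro x
    have h := ENNReal.ofReal_le_ofReal (norm_sigmaMart_Mprod_add_one_le hm hB hμ hf n x)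
    rw [ENNReal.ofReal_add (norm_nonneg _) (by positivity),
      ENNReal.ofReal_sum_of_nonneg fun k _ => by positivity] at h
    simp only [ofReal_norm] at h
    refine (ENNReal.rpow_le_rpow h hp0.le).trans ?_
    refine (ENNReal.rpow_add_le_add_rpow _ _ hp0.le hp1).trans ?_
    rw [add_zero, eq_of_toCell_eq (hf.2.1 n) (toCell_ofCell m n (toCell m n x))]
    gcongr
    refine (rpow_sum_le_sum_rpow _ _ hp0 hp1).trans (Finset.sum_le_sum fun k _ => ?_)
    rw [ENNReal.ofReal_sum_of_nonneg fun a _ => by positivity]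
    refine (rpow_sum_le_sum_rpow _ _ hp0 hp1).trans (Finset.sum_le_sum fun a _ => ?_)
    rw [ENNReal.ofReal_mul (by positivity), ENNReal.ofReal_mul (by positivity),
      ENNReal.ofReal_pow (by norm_num), ofReal_norm, ENNReal.ofReal_natCast,
      ENNReal.mul_rpow_of_nonneg _ _ hp0.le, ENNReal.mul_rpow_of_nonneg _ _ hp0.le,
      ← ENNReal.rpow_natCast, ← ENNReal.rpow_natCast, ← ENNReal.rpow_mul, ← ENNReal.rpow_mul,
      mul_comm p, one_div, ENNReal.ofReal_inv_of_pos (by norm_num)]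
    simp
  have hmeas : ∀ d : Cell m n,
      Measurable fun x => ‖f n (ofCell m n (toCell m n x + d))‖ₑ ^ p := fun d =>
    (measurable_of_countable fun c : Cell m n => ‖f n (ofCell m n (c + d))‖ₑ ^ p).comp
      (measurable_toCell m n)
  have hgeom : ∑ k : Fin n, ((2⁻¹ : ℝ≥0∞) ^ p) ^ (n - k.val) ≤ (1 - (2⁻¹ : ℝ≥0∞) ^ p)⁻¹ := by
    rw [Fin.sum_univ_eq_sum_range fun k => ((2⁻¹ : ℝ≥0∞) ^ p) ^ (n - k), ← ENNReal.tsum_geometric]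
    refine le_trans ?_ (ENNReal.sum_le_tsum (Finset.range (n + 1)))
    rw [Finset.sum_range_succ',
      ← Finset.sum_range_reflect fun k => ((2⁻¹ : ℝ≥0∞) ^ p) ^ (k + 1)]
    refine le_add_right (Finset.sum_congr rfl fun k hk => ?_).le
    have := Finset.mem_range.1 hk
    congr 1
    omega
  calc _ ≤ _ := lintegral_mono hpt
    _ = ∫⁻ x, ‖f n (ofCell m n (toCell m n x + 0))‖ₑ ^ p ∂μ +
        ∑ k : Fin n, ∑ a : ZMod (m k), ((2⁻¹ : ℝ≥0∞) ^ p) ^ (n - k.val) * (B : ℝ≥0∞) ^ p *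
          ∫⁻ x, ‖f n (ofCell m n (toCell m n x + Pi.single k a))‖ₑ ^ p ∂μ := by
        rw [lintegral_add_left (hmeas 0), lintegral_finsetSum]
        · congr 1
          refine Finset.sum_congr rfl fun k _ => ?_
          rw [lintegral_finsetSum]
          · exact Finset.sum_congr rfl fun a _ => lintegral_const_mul _ (hmeas _)
          · exact fun a _ => (hmeas _).const_mul _
        · exact fun k _ => Finset.measurable_sum _ fun a _ => (hmeas _).const_mul _
    _ ≤ A + ∑ k : Fin n, ∑ a : ZMod (m k),
        ((2⁻¹ : ℝ≥0∞) ^ p) ^ (n - k.val) * (B : ℝ≥0∞) ^ p * A := by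
        gcongr <;> exact lintegral_translate_rpow_le hμ hp0.le hf n _
    _ ≤ A + ∑ k : Fin n, ((2⁻¹ : ℝ≥0∞) ^ p) ^ (n - k.val) * (((B : ℝ≥0∞) ^ p * B) * A) := by
        gcongr with k
        rw [Finset.sum_const, Finset.card_univ, ZMod.card, nsmul_eq_mul]
        calc _ = ((2⁻¹ : ℝ≥0∞) ^ p) ^ (n - k.val) * (((B : ℝ≥0∞) ^ p * m k) * A) := by ring
          _ ≤ _ := by gcongr; exact hB k
    _ ≤ _ := by
        rw [← Finset.sum_mul, add_mul, one_mul, mul_assoc (1 - (2⁻¹ : ℝ≥0∞) ^ p)⁻¹]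
        gcongr

/-- Corollary 3(a): `‖σ_{M_n+1} f‖_{L_p} ≤ c_p M_n^{1/p-2} ‖f‖_{H_p}` for `0 < p < 1/2`. -/
theorem fejer_Mn_add_one_bound
    (m : ℕ → ℕ) (hm : ∀ n, 2 ≤ m n) (hbdd : ∃ B, ∀ n, m n ≤ B)
    (μ : Measure (G m)) (hμ : IsVilenkinMeasure m μ)
    (p : ℝ) (hp0 : 0 < p) (hp : p < 1 / 2) :
    ∃ c : ℝ≥0, 0 < c ∧
      ∀ f : ℕ → G m → ℂ, IsMartingale m μ f → hardyNorm m p μ f < ⊤ →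
        ∀ n : ℕ,
          eLpNorm (sigmaMart m μ f (Mprod m n + 1)) (ENNReal.ofReal p) μ ≤
            (c : ℝ≥0∞) * (Mprod m n : ℝ≥0∞) ^ (1 / p - 2) * hardyNorm m p μ f := by
  obtain ⟨B, hB⟩ := hbdd
  set C : ℝ≥0∞ := 1 + (1 - (2⁻¹ : ℝ≥0∞) ^ p)⁻¹ * ((B : ℝ≥0∞) ^ p * B) with hC
  have hlt : (2⁻¹ : ℝ≥0∞) ^ p < 1 := ENNReal.rpow_lt_one (by simp) hp0
  have hCtop : C ≠ ⊤ := by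
    refine ENNReal.add_ne_top.2 ⟨ENNReal.one_ne_top, ENNReal.mul_ne_top ?_ (ENNReal.mul_ne_top
      (ENNReal.rpow_ne_top_of_nonneg hp0.le (ENNReal.natCast_ne_top B))
      (ENNReal.natCast_ne_top B))⟩
    exact ENNReal.inv_ne_top.2 (tsub_pos_of_lt hlt).ne'
  have hC1 : 1 ≤ C ^ (1 / p) := ENNReal.one_le_rpow le_self_add (by positivity)
  have hCp : C ^ (1 / p) ≠ ⊤ := ENNReal.rpow_ne_top_of_nonneg (by positivity) hCtop
  refine ⟨(C ^ (1 / p)).toNNReal, ENNReal.toNNReal_pos (zero_lt_one.trans_le hC1).ne' hCp,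
    fun f hf _ n => ?_⟩
  have hp2 : 2 ≤ 1 / p := by
    rw [le_div_iff₀ hp0]
    linarith
  have hM : (1 : ℝ≥0∞) ≤ (Mprod m n : ℝ≥0∞) ^ (1 / p - 2) := by
    rcases hp2.eq_or_lt with h | h
    · simp [← h]
    · exact ENNReal.one_le_rpow (by exact_mod_cast Mprod_pos hm n) (by linarith)
  rw [ENNReal.coe_toNNReal hCp, eLpNorm_eq_lintegral_rpow_enorm_toReal
    (by simpa using hp0) ENNReal.ofReal_ne_top, ENNReal.toReal_ofReal hp0.le, hardyNorm]
  calc _ ≤ (C * ∫⁻ x, maximalFn m f x ^ p ∂μ) ^ (1 / p) :=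
        ENNReal.rpow_le_rpow (lintegral_sigmaMart_rpow_le hm hB hμ hp0 (by linarith) hf n)
          (by positivity)
    _ = C ^ (1 / p) * 1 * (∫⁻ x, maximalFn m f x ^ p ∂μ) ^ (1 / p) := by
        rw [ENNReal.mul_rpow_of_nonneg _ _ (by positivity), mul_one]
    _ ≤ _ := by gcongr

end Vilenkin
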